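/- arXiv:2512.04575 — 11 statements merged into one kernel-verified Lean document; each statement's English description precedes it below -/
import Mathlib

section
/- Let f : ℝ^n → ℝ be differentiable with gradient ∇f, assume ∇f is L-Lipschitz continuous with L > 0 and pseudo-monotone, and let x* be a stationary point of f (∇f(x*) = 0). Let 0 < h < 1/L and let β be a real number with (1 - √(1 - h²L²))/(h²L²) < β ≤ 1. Given a point x, define z = x - h∇f(x) and x⁺ = x - h(∇f(x) - β(∇f(x) - ∇f(z))). Then ‖x⁺ - x*‖² ≤ ‖x - x*‖² - (2β - 1 - β²h²L²)‖x - z‖². -/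
open scoped RealInnerProductSpace

/-- Proposition 3.1: single-iteration Fejér monotonicity estimate for the improved
prediction-correction algorithm with constant step size (Algorithm 1). -/
theorem stmt_0 {n : ℕ} (f : EuclideanSpace ℝ (Fin n) → ℝ)
    (g : EuclideanSpace ℝ (Fin n) → EuclideanSpace ℝ (Fin n))
    (hdiff : ∀ x, HasGradientAt f (g x) x)
    (L : ℝ) (hL : 0 < L)
    (hLip : ∀ x y, ‖g y - g x‖ ≤ L * ‖y - x‖)
    (hpm : ∀ x y, 0 ≤ ⟪g x, y - x⟫ → 0 ≤ ⟪g y, y - x⟫)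
    (xstar : EuclideanSpace ℝ (Fin n)) (hstar : g xstar = 0)
    (h : ℝ) (hh0 : 0 < h) (hh1 : h < 1 / L)
    (β : ℝ) (hβlo : (1 - Real.sqrt (1 - h ^ 2 * L ^ 2)) / (h ^ 2 * L ^ 2) < β)
    (hβhi : β ≤ 1)
    (x z xp : EuclideanSpace ℝ (Fin n))
    (hz : z = x - h • g x)
    (hxp : xp = x - h • (g x - β • (g x - g z))) :
    ‖xp - xstar‖ ^ 2 ≤ ‖x - xstar‖ ^ 2 - (2 * β - 1 - β ^ 2 * h ^ 2 * L ^ 2) * ‖x - z‖ ^ 2 := by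
  have hβ : 0 ≤ β := by
    refine le_trans (div_nonneg (sub_nonneg.2 ?_) (by positivity)) hβlo.le
    exact Real.sqrt_le_one.2 (by nlinarith [sq_nonneg (h * L)])
  have hmon : ∀ y, 0 ≤ ⟪g y, y - xstar⟫ := fun y => hpm xstar y (by simp [hstar])
  have hxz : x - z = h • g x := by rw [hz]; abel
  have hnorm : ‖x - z‖ ^ 2 = h ^ 2 * ‖g x‖ ^ 2 := by
    rw [hxz, norm_smul, mul_pow, Real.norm_eq_abs, sq_abs]
  have hlip : ‖g x - g z‖ ^ 2 ≤ L ^ 2 * (h ^ 2 * ‖g x‖ ^ 2) := by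
    rw [← hnorm, ← mul_pow]
    exact pow_le_pow_left₀ (norm_nonneg _) (hLip z x) 2
  have hgz : h * ⟪g z, g x⟫ ≤ ⟪g z, x - xstar⟫ := by
    have hsplit : x - xstar = (z - xstar) + h • g x := by rw [← hxz]; abel
    rw [hsplit, inner_add_right, real_inner_smul_right]
    linarith [hmon z]
  have hexp : ‖xp - xstar‖ ^ 2 = ‖x - xstar‖ ^ 2
      - 2 * h * ((1 - β) * ⟪g x, x - xstar⟫ + β * ⟪g z, x - xstar⟫)
      + h ^ 2 * (‖g x‖ ^ 2 - 2 * β * (‖g x‖ ^ 2 - ⟪g z, g x⟫)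
        + β ^ 2 * ‖g x - g z‖ ^ 2) := by
    have hsplit : xp - xstar = (x - xstar) - h • (g x - β • (g x - g z)) := by rw [hxp]; abel
    rw [hsplit]
    simp only [← real_inner_self_eq_norm_sq, inner_sub_left, inner_sub_right,
      real_inner_smul_left, real_inner_smul_right, real_inner_comm (g x) (g z),
      real_inner_comm (g x) x, real_inner_comm (g z) x, real_inner_comm (g x) xstar,
      real_inner_comm (g z) xstar, real_inner_comm x xstar]
    ring
  rw [hexp, hnorm]
  have hx_term := mul_nonneg (mul_nonneg hh0.le (sub_nonneg.2 hβhi)) (hmon x)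
  have hz_term := mul_le_mul_of_nonneg_left hgz (mul_nonneg hh0.le hβ)
  have hlip_term := mul_le_mul_of_nonneg_left hlip (by positivity : 0 ≤ h ^ 2 * β ^ 2)
  linarith
end

section
/- Let f : ℝ^n → ℝ be differentiable with gradient ∇f, assume ∇f is L-Lipschitz continuous with L > 0 and pseudo-monotone, and assume the stationary point set X* = {x : ∇f(x) = 0} is nonempty. Let 0 < h < 1/L and (1 - √(1 - h²L²))/(h²L²) < β ≤ 1. Define the sequence {x^k} from an arbitrary x⁰ by z^k = x^k - h∇f(x^k) and x^{k+1} = x^k - h(∇f(x^k) - β(∇f(x^k) - ∇f(z^k))). Then {x^k} converges to a point x^∞ with ∇f(x^∞) = 0. -/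
open scoped RealInnerProductSpace
open Filter

/-- The admissible lower bound on `β` is the smaller root of `r² β² - 2 β + 1`, and the larger root
exceeds `1`. -/
lemma two_mul_sub_one_sub_sq_mul_sq_pos {r β : ℝ} (hr0 : 0 < r) (hr1 : r < 1)
    (hlo : (1 - Real.sqrt (1 - r ^ 2)) / r ^ 2 < β) (hhi : β ≤ 1) :
    0 < 2 * β - 1 - β ^ 2 * r ^ 2 := by
  have hr2 : 0 < r ^ 2 := by positivity
  have hs : 0 < 1 - r ^ 2 := by nlinarith
  have hsq := Real.sq_sqrt hs.le
  have hs0 := Real.sqrt_pos.2 hs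
  rw [div_lt_iff₀ hr2] at hlo
  have hup : β * r ^ 2 < 1 + Real.sqrt (1 - r ^ 2) := by nlinarith
  have key : 0 < r ^ 2 * (2 * β - 1 - β ^ 2 * r ^ 2) := by
    nlinarith [mul_pos (sub_pos.2 hlo) (sub_pos.2 hup)]
  exact pos_of_mul_pos_right key hr2.le

/-- One corrected step does not increase the distance to a stationary point, with a gain
proportional to the squared norm of the operator value. -/
lemma norm_sub_sq_corrected_step_le {E : Type*} [NormedAddCommGroup E] [InnerProductSpace ℝ E]
    {u w p q : E} {h r β : ℝ} (hh : 0 ≤ h) (hβ0 : 0 ≤ β) (hβ1 : β ≤ 1)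
    (hu : 0 ≤ ⟪u, p - q⟫) (hw : 0 ≤ ⟪w, p - h • u - q⟫) (huw : ‖u - w‖ ≤ r * ‖u‖) :
    ‖p - h • (u - β • (u - w)) - q‖ ^ 2 ≤
      ‖p - q‖ ^ 2 - h ^ 2 * (2 * β - 1 - β ^ 2 * r ^ 2) * ‖u‖ ^ 2 := by
  have hsq : ‖u - w‖ ^ 2 ≤ r ^ 2 * ‖u‖ ^ 2 := by
    rw [← mul_pow]; exact pow_le_pow_left₀ (norm_nonneg _) huw 2
  have e1 : p - h • (u - β • (u - w)) - q = (p - q) - h • (u - β • (u - w)) := by abel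
  have e2 : p - h • u - q = (p - q) - h • u := by abel
  rw [e2] at hw
  rw [e1]
  generalize p - q = d at *
  rw [norm_sub_sq_real] at hsq
  simp only [← real_inner_self_eq_norm_sq, inner_sub_left, inner_sub_right, inner_smul_left,
    inner_smul_right, RCLike.conj_to_real] at *
  rw [real_inner_comm u d, real_inner_comm w d, real_inner_comm u w] at *
  have h1 : 0 ≤ h * (1 - β) * ⟪u, d⟫ := mul_nonneg (mul_nonneg hh (sub_nonneg.2 hβ1)) hu
  have h2 := mul_nonneg (mul_nonneg hh hβ0) hw
  have h3 := mul_le_mul_of_nonneg_left hsq (by positivity : 0 ≤ h ^ 2 * β ^ 2)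
  nlinarith

/-- A sequence whose squared distance to every zero of a continuous map `g` decreases by at least
`c * ‖g (x k)‖ ^ 2` at each step converges to a zero of `g`. -/
lemma exists_tendsto_zero_of_norm_sub_sq_succ_le {E F : Type*} [NormedAddCommGroup E]
    [ProperSpace E] [NormedAddCommGroup F] {g : E → F} (hg : Continuous g) (hX : ∃ q, g q = 0)
    {c : ℝ} (hc : 0 < c) {x : ℕ → E}
    (hx : ∀ q, g q = 0 → ∀ k, ‖x (k + 1) - q‖ ^ 2 ≤ ‖x k - q‖ ^ 2 - c * ‖g (x k)‖ ^ 2) :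
    ∃ q, g q = 0 ∧ Tendsto x atTop (nhds q) := by
  have anti : ∀ q, g q = 0 → Antitone fun k => ‖x k - q‖ := fun q hq =>
    antitone_nat_of_succ_le fun k =>
      (sq_le_sq₀ (norm_nonneg _) (norm_nonneg _)).1
        (by nlinarith [hx q hq k, mul_nonneg hc.le (sq_nonneg ‖g (x k)‖)])
  obtain ⟨p, hp⟩ := hX
  have hlim : Tendsto (fun k => ‖x k - p‖) atTop (nhds (⨅ k, ‖x k - p‖)) :=
    tendsto_atTop_ciInf (anti p hp) ⟨0, by rintro _ ⟨k, rfl⟩; exact norm_nonneg _⟩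
  have hgap : Tendsto (fun k => (‖x k - p‖ ^ 2 - ‖x (k + 1) - p‖ ^ 2) / c) atTop (nhds 0) := by
    simpa using ((hlim.pow 2).sub (((tendsto_add_atTop_iff_nat 1).2 hlim).pow 2)).div_const c
  have hsq : Tendsto (fun k => ‖g (x k)‖ ^ 2) atTop (nhds 0) :=
    squeeze_zero (fun k => sq_nonneg _)
      (fun k => by rw [le_div_iff₀ hc]; linarith [hx p hp k]) hgap
  have hnorm : Tendsto (fun k => ‖g (x k)‖) atTop (nhds 0) := by
    simpa [Real.sqrt_sq] using hsq.sqrt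
  obtain ⟨q, -, φ, hφ, hq⟩ := (isCompact_closedBall p ‖x 0 - p‖).tendsto_subseq
    (x := x) fun k => by
      rw [mem_closedBall_iff_norm]; exact anti p hp (Nat.zero_le k)
  have hgq : g q = 0 := tendsto_nhds_unique ((hg.tendsto q).comp hq)
    ((tendsto_zero_iff_norm_tendsto_zero.2 hnorm).comp hφ.tendsto_atTop)
  refine ⟨q, hgq, tendsto_iff_norm_sub_tendsto_zero.2 ?_⟩
  exact (tendsto_iff_tendsto_subseq_of_antitone (anti q hgq) hφ.tendsto_atTop).2
    (tendsto_iff_norm_sub_tendsto_zero.1 hq)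

/-- Theorem 3.1: global convergence of the improved prediction-correction algorithm
with constant step size (Algorithm 1). -/
theorem stmt_3 {n : ℕ} (f : EuclideanSpace ℝ (Fin n) → ℝ)
    (g : EuclideanSpace ℝ (Fin n) → EuclideanSpace ℝ (Fin n))
    (hdiff : ∀ x, HasGradientAt f (g x) x)
    (L : ℝ) (hL : 0 < L)
    (hLip : ∀ x y, ‖g y - g x‖ ≤ L * ‖y - x‖)
    (hpm : ∀ x y, 0 ≤ ⟪g x, y - x⟫ → 0 ≤ ⟪g y, y - x⟫)
    (hX : ∃ xstar, g xstar = 0)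
    (h : ℝ) (hh0 : 0 < h) (hh1 : h < 1 / L)
    (β : ℝ) (hβlo : (1 - Real.sqrt (1 - h ^ 2 * L ^ 2)) / (h ^ 2 * L ^ 2) < β)
    (hβhi : β ≤ 1)
    (x z : ℕ → EuclideanSpace ℝ (Fin n))
    (hz : ∀ k, z k = x k - h • g (x k))
    (hx : ∀ k, x (k + 1) = x k - h • (g (x k) - β • (g (x k) - g (z k)))) :
    ∃ xinf, g xinf = 0 ∧ Tendsto x atTop (nhds xinf) := by
  have hr0 : 0 < h * L := mul_pos hh0 hL
  have hr1 : h * L < 1 := (lt_div_iff₀ hL).1 hh1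
  rw [← mul_pow] at hβlo
  have hgain := two_mul_sub_one_sub_sq_mul_sq_pos hr0 hr1 hβlo hβhi
  have hβ0 : 0 ≤ β := by nlinarith [sq_nonneg (β * (h * L))]
  have hcont : Continuous g := (LipschitzWith.of_dist_le_mul (K := ⟨L, hL.le⟩) fun a b => by
    rw [dist_eq_norm, dist_eq_norm]; exact hLip b a).continuous
  refine exists_tendsto_zero_of_norm_sub_sq_succ_le hcont hX
    (mul_pos (pow_pos hh0 2) hgain) fun q hq k => ?_
  have hmono : ∀ y, 0 ≤ ⟪g y, y - q⟫ := fun y => hpm q y (by simp [hq])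
  rw [hx k]
  refine norm_sub_sq_corrected_step_le hh0.le hβ0 hβhi (hmono _) (hz k ▸ hmono (z k)) ?_
  refine (hLip (z k) (x k)).trans_eq ?_
  rw [hz k, sub_sub_cancel, norm_smul, Real.norm_of_nonneg hh0.le]
  ring
end

section
/- Let f : ℝ^n → ℝ be differentiable with gradient ∇f, assume ∇f is L-Lipschitz continuous with L > 0 and pseudo-monotone, and let x* be a point with ∇f(x*) = 0. Let 0 < h < 1/L and (1 - √(1 - h²L²))/(h²L²) < β ≤ 1, and set κ₁ = 2β - 1 - β²h²L². Define the sequence {x^k} from an arbitrary x⁰ by z^k = x^k - h∇f(x^k) and x^{k+1} = x^k - h(∇f(x^k) - β(∇f(x^k) - ∇f(z^k))). Then for every positive integer K, (1/K)·Σ_{k=0}^{K-1} ‖∇f(x^k)‖² ≤ ‖x⁰ - x*‖²/(K·κ₁·h²). -/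
open scoped RealInnerProductSpace

/-- The quadratic `2β - 1 - β²t` is positive when `β` lies strictly above its smaller root and
`β ≤ 1`. -/
lemma quadratic_pos_of_root_lt {t β : ℝ} (ht0 : 0 < t) (ht1 : t < 1)
    (hlo : (1 - Real.sqrt (1 - t)) / t < β) (hhi : β ≤ 1) :
    0 < 2 * β - 1 - β ^ 2 * t := by
  have hs : Real.sqrt (1 - t) ^ 2 = 1 - t := Real.sq_sqrt (by linarith)
  have hs0 : 0 ≤ Real.sqrt (1 - t) := Real.sqrt_nonneg _
  rw [div_lt_iff₀ ht0] at hlo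
  have hβt : β * t ≤ t := by nlinarith
  have hsq : (1 - β * t) ^ 2 < Real.sqrt (1 - t) ^ 2 :=
    pow_lt_pow_left₀ (by linarith) (by linarith) two_ne_zero
  have hprod : 0 < t * (2 * β - 1 - β ^ 2 * t) := by nlinarith
  exact pos_of_mul_pos_right hprod ht0.le

/-- One step of the corrected gradient iteration decreases the squared distance to a zero of the
operator. -/
lemma norm_sub_sq_le_of_corrected_step {E : Type*} [NormedAddCommGroup E] [InnerProductSpace ℝ E]
    {g : E → E} {L h β : ℝ} (hLip : ∀ x y, ‖g y - g x‖ ≤ L * ‖y - x‖)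
    (hpm : ∀ x y, 0 ≤ ⟪g x, y - x⟫ → 0 ≤ ⟪g y, y - x⟫)
    {p : E} (hp : g p = 0) (hh : 0 ≤ h) (hβ0 : 0 ≤ β) (hβ1 : β ≤ 1) (u : E) :
    ‖u - h • (g u - β • (g u - g (u - h • g u))) - p‖ ^ 2 ≤
      ‖u - p‖ ^ 2 - (2 * β - 1 - β ^ 2 * h ^ 2 * L ^ 2) * h ^ 2 * ‖g u‖ ^ 2 := by
  have hnonneg (y : E) : 0 ≤ ⟪g y, y - p⟫ := hpm p y (by simp [hp])
  have hu := hnonneg u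
  have hv := hnonneg (u - h • g u)
  have hE : ‖g u - g (u - h • g u)‖ ≤ L * (h * ‖g u‖) := by
    simpa [norm_smul, abs_of_nonneg hh] using hLip (u - h • g u) u
  have hE2 := pow_le_pow_left₀ (norm_nonneg _) hE 2
  generalize g (u - h • g u) = b at *
  rw [show u - h • g u - p = (u - p) - h • g u by abel] at hv
  rw [show u - h • (g u - β • (g u - b)) - p = (u - p) - h • (g u - β • (g u - b)) by abel]
  generalize u - p = d at *
  generalize g u = a at *
  rw [← real_inner_self_eq_norm_sq (a - b)] at hE2
  simp only [← real_inner_self_eq_norm_sq, mul_pow, inner_sub_left, inner_sub_right,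
    real_inner_smul_left, real_inner_smul_right] at *
  rw [real_inner_comm a b] at *
  rw [real_inner_comm a d, real_inner_comm b d] at *
  have h1 := mul_nonneg (mul_nonneg hh (sub_nonneg.2 hβ1)) hu
  have h2 := mul_nonneg (mul_nonneg hh hβ0) hv
  have h3 := mul_le_mul_of_nonneg_left hE2 (mul_nonneg (sq_nonneg h) (sq_nonneg β))
  linarith


/-- Theorem 3.2: ergodic O(1/K) convergence rate of the squared gradient norms
for Algorithm 1. -/
theorem stmt_4 {n : ℕ} (f : EuclideanSpace ℝ (Fin n) → ℝ)
    (g : EuclideanSpace ℝ (Fin n) → EuclideanSpace ℝ (Fin n))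
    (hdiff : ∀ x, HasGradientAt f (g x) x)
    (L : ℝ) (hL : 0 < L)
    (hLip : ∀ x y, ‖g y - g x‖ ≤ L * ‖y - x‖)
    (hpm : ∀ x y, 0 ≤ ⟪g x, y - x⟫ → 0 ≤ ⟪g y, y - x⟫)
    (xstar : EuclideanSpace ℝ (Fin n)) (hstar : g xstar = 0)
    (h : ℝ) (hh0 : 0 < h) (hh1 : h < 1 / L)
    (β : ℝ) (hβlo : (1 - Real.sqrt (1 - h ^ 2 * L ^ 2)) / (h ^ 2 * L ^ 2) < β)
    (hβhi : β ≤ 1)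
    (κ₁ : ℝ) (hκ : κ₁ = 2 * β - 1 - β ^ 2 * h ^ 2 * L ^ 2)
    (x z : ℕ → EuclideanSpace ℝ (Fin n))
    (hz : ∀ k, z k = x k - h • g (x k))
    (hx : ∀ k, x (k + 1) = x k - h • (g (x k) - β • (g (x k) - g (z k))))
    (K : ℕ) (hK : 0 < K) :
    (1 / (K : ℝ)) * ∑ k ∈ Finset.range K, ‖g (x k)‖ ^ 2 ≤
      ‖x 0 - xstar‖ ^ 2 / ((K : ℝ) * κ₁ * h ^ 2) := by
  have hhL : h * L < 1 := (lt_div_iff₀ hL).1 hh1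
  have ht0 : 0 < h ^ 2 * L ^ 2 := by positivity
  have ht1 : h ^ 2 * L ^ 2 < 1 := by
    rw [← mul_pow]
    exact pow_lt_one₀ (by positivity) hhL two_ne_zero
  have hκ0 : 0 < κ₁ := by
    rw [hκ, mul_assoc]
    exact quadratic_pos_of_root_lt ht0 ht1 hβlo hβhi
  have hβ0 : 0 ≤ β := by
    have hpos : 0 ≤ β ^ 2 * h ^ 2 * L ^ 2 := by positivity
    linarith
  have hstep (k : ℕ) :
      κ₁ * h ^ 2 * ‖g (x k)‖ ^ 2 ≤ ‖x k - xstar‖ ^ 2 - ‖x (k + 1) - xstar‖ ^ 2 := by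
    have := norm_sub_sq_le_of_corrected_step hLip hpm hstar hh0.le hβ0 hβhi (x k)
    rw [← hz, ← hx, ← hκ] at this
    linarith
  have hsum : κ₁ * h ^ 2 * ∑ k ∈ Finset.range K, ‖g (x k)‖ ^ 2 ≤ ‖x 0 - xstar‖ ^ 2 := by
    rw [Finset.mul_sum]
    refine (Finset.sum_le_sum fun k _ => hstep k).trans ?_
    rw [Finset.sum_range_sub' fun k => ‖x k - xstar‖ ^ 2]
    exact sub_le_self _ (sq_nonneg _)
  have hK0 : (0 : ℝ) < K := Nat.cast_pos.2 hK
  rw [le_div_iff₀ (by positivity)]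
  calc _ = κ₁ * h ^ 2 * ∑ k ∈ Finset.range K, ‖g (x k)‖ ^ 2 := by field_simp
    _ ≤ _ := hsum
end

section
/- Let f : ℝ^n → ℝ be differentiable with L-Lipschitz continuous gradient ∇f (L > 0), let x be a point with ∇f(x) ≠ 0, let 0 < ν < 1 and θ ∈ (0,1), and for γ > 0 set z(γ) = x - γ∇f(x) and r(γ) = γ‖∇f(z(γ)) - ∇f(x)‖/‖z(γ) - x‖. Define a sequence of trial step sizes starting from any γ₀ > 0 by γ_{l+1} = γ_l · θ · min{1, 1/r(γ_l)} (applied whenever r(γ_l) > ν). Then there exists a finite index l such that r(γ_l) ≤ ν; that is, the line search terminates in finitely many steps. -/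
/-- Lemma 3.1: finite termination of the backtracking line search of the
adaptive-step prediction-correction algorithms. -/
theorem stmt_5 {n : ℕ} (f : EuclideanSpace ℝ (Fin n) → ℝ)
    (g : EuclideanSpace ℝ (Fin n) → EuclideanSpace ℝ (Fin n))
    (hdiff : ∀ x, HasGradientAt f (g x) x)
    (L : ℝ) (hL : 0 < L)
    (hLip : ∀ x y, ‖g y - g x‖ ≤ L * ‖y - x‖)
    (x : EuclideanSpace ℝ (Fin n)) (hx : g x ≠ 0)
    (ν θ : ℝ) (hν : 0 < ν) (hν1 : ν < 1) (hθ : 0 < θ) (hθ1 : θ < 1)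
    (r : ℝ → ℝ)
    (hr : ∀ γ, r γ = γ * ‖g (x - γ • g x) - g x‖ / ‖(x - γ • g x) - x‖)
    (γ : ℕ → ℝ) (hγ0 : 0 < γ 0)
    (hupd : ∀ l, ν < r (γ l) → γ (l + 1) = γ l * θ * min 1 (1 / r (γ l))) :
    ∃ l, r (γ l) ≤ ν := by
  by_contra! h
  have hr_le : ∀ t, 0 ≤ t → r t ≤ t * L := by
    intro t ht
    rw [hr t]
    refine div_le_of_le_mul₀ (norm_nonneg _) (by positivity) ?_
    rw [mul_assoc]
    exact mul_le_mul_of_nonneg_left (hLip _ _) ht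
  have hdecay : ∀ l, 0 < γ l ∧ γ l ≤ γ 0 * θ ^ l := by
    intro l
    induction l with
    | zero => simpa using hγ0
    | succ k ih =>
      obtain ⟨hpos, hle⟩ := ih
      have hrpos : 0 < r (γ k) := hν.trans (h k)
      rw [hupd k (h k)]
      refine ⟨mul_pos (mul_pos hpos hθ) (lt_min one_pos (one_div_pos.2 hrpos)), ?_⟩
      calc γ k * θ * min 1 (1 / r (γ k)) ≤ γ k * θ :=
            mul_le_of_le_one_right (mul_pos hpos hθ).le (min_le_left _ _)
        _ ≤ γ 0 * θ ^ k * θ := mul_le_mul_of_nonneg_right hle hθ.le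
        _ = γ 0 * θ ^ (k + 1) := by ring
  obtain ⟨l, hl⟩ := exists_pow_lt_of_lt_one (div_pos hν (mul_pos hγ0 hL)) hθ1
  rw [lt_div_iff₀ (mul_pos hγ0 hL)] at hl
  have hlt := (h l).trans_le (hr_le _ (hdecay l).1.le)
  have hle := mul_le_mul_of_nonneg_right (hdecay l).2 hL.le
  linarith
end

section
/- Let f : ℝ^n → ℝ be differentiable with L-Lipschitz continuous gradient ∇f, where L ≥ 1, let x be a point with ∇f(x) ≠ 0, let 0 < ν < 1, θ ∈ (0,1), 0 < h̲ and h̄ ≥ 1, and for γ > 0 set z(γ) = x - γ∇f(x) and r(γ) = γ‖∇f(z(γ)) - ∇f(x)‖/‖z(γ) - x‖. Suppose the line search starts from γ₀ ∈ [h̲, h̄], updates by γ_{l+1} = γ_l · θ · min{1, 1/r(γ_l)} while r(γ_l) > ν, and returns h = γ_l at the first index l where r(γ_l) ≤ ν. Then the returned step size satisfies h ≥ min{h̲, νθ/(h̄L²)}. -/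
/-- The scaled difference quotient of an `L`-Lipschitz map is at most `γ * L`. -/
theorem mul_norm_sub_div_norm_sub_le {E F : Type*} [SeminormedAddCommGroup E]
    [SeminormedAddCommGroup F] {g : E → F} {L γ : ℝ} (hL : 0 ≤ L) (hγ : 0 ≤ γ)
    (hg : ∀ x y, ‖g y - g x‖ ≤ L * ‖y - x‖) (x y : E) :
    γ * ‖g y - g x‖ / ‖y - x‖ ≤ γ * L := by
  rw [mul_div_assoc]
  exact mul_le_mul_of_nonneg_left (div_le_of_le_mul₀ (norm_nonneg _) hL (hg x y)) hγ

/-- One rejected step of the line search leaves the step size above `ν * θ / (b * L ^ 2)`. -/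
theorem div_le_lineSearch_update {L ν θ b γ r : ℝ} (hL : 1 ≤ L) (hν : 0 ≤ ν) (hν1 : ν ≤ 1)
    (hθ : 0 ≤ θ) (hb : 1 ≤ b) (hγ : 0 < γ) (hνr : ν < r) (hr : r ≤ γ * L) :
    ν * θ / (b * L ^ 2) ≤ γ * θ * min 1 (1 / r) := by
  have hLpos : 0 < L := by linarith
  have hr0 : 0 < r := hν.trans_lt hνr
  have hmin : ν / L ≤ γ * min 1 (1 / r) := by
    rw [mul_min_of_nonneg _ _ hγ.le, mul_one, mul_one_div]
    refine le_min ?_ ?_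
    · rw [div_le_iff₀ hLpos]
      linarith
    · rw [div_le_div_iff₀ hLpos hr0]
      exact (mul_le_of_le_one_left hr0.le hν1).trans hr
  calc ν * θ / (b * L ^ 2) ≤ ν * θ / L := by
        gcongr
        nlinarith [mul_le_mul_of_nonneg_right hb (sq_nonneg L)]
    _ = θ * (ν / L) := by ring
    _ ≤ θ * (γ * min 1 (1 / r)) := mul_le_mul_of_nonneg_left hmin hθ
    _ = γ * θ * min 1 (1 / r) := by ring

/-- Lemma 3.2: the step size returned by the line search in Algorithm 2 is
bounded below by min{h̲, νθ/(h̄ L²)}. -/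
theorem stmt_6 {n : ℕ} (f : EuclideanSpace ℝ (Fin n) → ℝ)
    (g : EuclideanSpace ℝ (Fin n) → EuclideanSpace ℝ (Fin n))
    (hdiff : ∀ x, HasGradientAt f (g x) x)
    (L : ℝ) (hL : 1 ≤ L)
    (hLip : ∀ x y, ‖g y - g x‖ ≤ L * ‖y - x‖)
    (x : EuclideanSpace ℝ (Fin n)) (hx : g x ≠ 0)
    (ν θ hlow hup : ℝ) (hν : 0 < ν) (hν1 : ν < 1) (hθ : 0 < θ) (hθ1 : θ < 1)
    (hlow0 : 0 < hlow) (hup1 : 1 ≤ hup)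
    (r : ℝ → ℝ)
    (hr : ∀ γ, r γ = γ * ‖g (x - γ • g x) - g x‖ / ‖(x - γ • g x) - x‖)
    (γ : ℕ → ℝ) (hγ0 : γ 0 ∈ Set.Icc hlow hup)
    (hupd : ∀ l, ν < r (γ l) → γ (l + 1) = γ l * θ * min 1 (1 / r (γ l)))
    (l : ℕ) (hterm : r (γ l) ≤ ν) (hfirst : ∀ m < l, ν < r (γ m))
    (h : ℝ) (hret : h = γ l) :
    min hlow (ν * θ / (hup * L ^ 2)) ≤ h := by
  subst hret
  have hLpos : 0 < L := by linarith
  have hpos : ∀ m ≤ l, 0 < γ m := by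
    intro m
    induction m with
    | zero => exact fun _ => hlow0.trans_le hγ0.1
    | succ m ih =>
      intro hm
      have hrm := hfirst m hm
      have hγm := ih (Nat.le_of_succ_le hm)
      have hr0 : 0 < r (γ m) := hν.trans hrm
      rw [hupd m hrm]
      positivity
  cases l with
  | zero => exact (min_le_left _ _).trans hγ0.1
  | succ m =>
    refine (min_le_right _ _).trans ?_
    have hrm := hfirst m m.lt_succ_self
    rw [hupd m hrm]
    exact div_le_lineSearch_update hL hν.le hν1.le hθ.le hup1 (hpos m m.le_succ) hrm
      (hr (γ m) ▸ mul_norm_sub_div_norm_sub_le hLpos.le (hpos m m.le_succ).le hLip _ _)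
end

section
/- Let f : ℝ^n → ℝ be differentiable with gradient ∇f, assume ∇f is pseudo-monotone, and let x* be a point with ∇f(x*) = 0. Let 0 < ν < 1 and let β satisfy (1 - √(1 - ν²))/ν² < β ≤ 1. Given a point x and a step size h > 0, define z = x - h∇f(x), and assume the line search condition h‖∇f(z) - ∇f(x)‖ ≤ ν‖z - x‖ holds. Let x⁺ = x - h(∇f(x) - β(∇f(x) - ∇f(z))). Then ‖x⁺ - x*‖² ≤ ‖x - x*‖² - (2β - 1 - β²ν²)‖x - z‖², and 2β - 1 - β²ν² > 0. -/
open scoped RealInnerProductSpace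

/-- The interval of relaxation parameters on which the contraction factor is positive. -/
lemma relaxation_factor_pos {ν β : ℝ} (hν : 0 < ν) (hν1 : ν < 1)
    (hβlo : (1 - Real.sqrt (1 - ν ^ 2)) / ν ^ 2 < β) (hβhi : β ≤ 1) :
    0 < 2 * β - 1 - β ^ 2 * ν ^ 2 := by
  have hν2 : 0 < ν ^ 2 := by positivity
  have hν2' : ν ^ 2 < 1 := by nlinarith
  have hs := Real.sq_sqrt (sub_nonneg.2 hν2'.le)
  rw [div_lt_iff₀ hν2] at hβlo
  have hle : β * ν ^ 2 ≤ ν ^ 2 := mul_le_of_le_one_left hν2.le hβhi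
  have hsq : (1 - β * ν ^ 2) ^ 2 < Real.sqrt (1 - ν ^ 2) ^ 2 :=
    pow_lt_pow_left₀ (by linarith) (by linarith) two_ne_zero
  refine pos_of_mul_pos_right (a := ν ^ 2) ?_ hν2.le
  linarith

/-- One prediction-correction step, with `a` the prediction direction, `b` the direction at the
predicted point and `u` the offset from the solution. -/
lemma norm_sub_correction_sq_le {E : Type*} [NormedAddCommGroup E] [InnerProductSpace ℝ E]
    {a b u : E} {β ν : ℝ} (hβ0 : 0 ≤ β) (hβ1 : β ≤ 1)
    (ha : 0 ≤ ⟪a, u⟫) (hb : 0 ≤ ⟪b, u - a⟫) (hab : ‖a - b‖ ≤ ν * ‖a‖) :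
    ‖u - (a - β • (a - b))‖ ^ 2 ≤ ‖u‖ ^ 2 - (2 * β - 1 - β ^ 2 * ν ^ 2) * ‖a‖ ^ 2 := by
  have hsq : β ^ 2 * ‖a - b‖ ^ 2 ≤ β ^ 2 * (ν * ‖a‖) ^ 2 := by gcongr
  have ha' := mul_nonneg (sub_nonneg.2 hβ1) ha
  have hb' := mul_nonneg hβ0 hb
  simp only [← real_inner_self_eq_norm_sq, mul_pow, inner_sub_left, inner_sub_right,
    real_inner_smul_left, real_inner_smul_right] at hsq ha' hb' ⊢
  rw [real_inner_comm a b, real_inner_comm a u, real_inner_comm b u] at *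
  linarith

/-- Proposition 3.2: single-iteration Fejér monotonicity estimate for the improved
prediction-correction algorithm with adaptive step size (Algorithm 2). -/
theorem stmt_7 {n : ℕ} (f : EuclideanSpace ℝ (Fin n) → ℝ)
    (g : EuclideanSpace ℝ (Fin n) → EuclideanSpace ℝ (Fin n))
    (hdiff : ∀ x, HasGradientAt f (g x) x)
    (hpm : ∀ x y, 0 ≤ ⟪g x, y - x⟫ → 0 ≤ ⟪g y, y - x⟫)
    (xstar : EuclideanSpace ℝ (Fin n)) (hstar : g xstar = 0)
    (ν : ℝ) (hν : 0 < ν) (hν1 : ν < 1)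
    (β : ℝ) (hβlo : (1 - Real.sqrt (1 - ν ^ 2)) / ν ^ 2 < β) (hβhi : β ≤ 1)
    (x z xp : EuclideanSpace ℝ (Fin n)) (h : ℝ) (hh : 0 < h)
    (hz : z = x - h • g x)
    (hls : h * ‖g z - g x‖ ≤ ν * ‖z - x‖)
    (hxp : xp = x - h • (g x - β • (g x - g z))) :
    ‖xp - xstar‖ ^ 2 ≤ ‖x - xstar‖ ^ 2 - (2 * β - 1 - β ^ 2 * ν ^ 2) * ‖x - z‖ ^ 2 ∧
      0 < 2 * β - 1 - β ^ 2 * ν ^ 2 := by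
  have hpos := relaxation_factor_pos hν hν1 hβlo hβhi
  have hβ0 : 0 ≤ β := by nlinarith [mul_nonneg (sq_nonneg β) (sq_nonneg ν)]
  have hsol : ∀ y, 0 ≤ ⟪g y, y - xstar⟫ := fun y => hpm xstar y (by simp [hstar])
  have hxz : x - z = h • g x := by rw [hz]; abel
  have ha : 0 ≤ ⟪h • g x, x - xstar⟫ := by
    rw [real_inner_smul_left]
    exact mul_nonneg hh.le (hsol x)
  have hb : 0 ≤ ⟪h • g z, x - xstar - h • g x⟫ := by
    rw [real_inner_smul_left, ← hxz, show x - xstar - (x - z) = z - xstar by abel]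
    exact mul_nonneg hh.le (hsol z)
  have hab : ‖h • g x - h • g z‖ ≤ ν * ‖h • g x‖ := by
    rwa [← smul_sub, ← hxz, norm_smul, Real.norm_of_nonneg hh.le, norm_sub_rev (g x),
      norm_sub_rev x]
  refine ⟨?_, hpos⟩
  have hstep : xp - xstar = x - xstar - (h • g x - β • (h • g x - h • g z)) := by
    rw [hxp]; module
  rw [hstep, hxz]
  exact norm_sub_correction_sq_le hβ0 hβhi ha hb hab
end

section
/- Let f : ℝ^n → ℝ be differentiable with gradient ∇f, assume ∇f is L-Lipschitz continuous with L > 0 and pseudo-monotone, and assume the stationary point set X* = {x : ∇f(x) = 0} is nonempty. Let 0 < ν < 1, let β satisfy (1 - √(1 - ν²))/ν² < β ≤ 1, and let h_min > 0. Suppose the sequences {x^k}, {z^k} and step sizes {h_k} satisfy, for every k: h_k ≥ h_min, z^k = x^k - h_k∇f(x^k), the line search condition h_k‖∇f(z^k) - ∇f(x^k)‖ ≤ ν‖z^k - x^k‖, and x^{k+1} = x^k - h_k(∇f(x^k) - β(∇f(x^k) - ∇f(z^k))). Then {x^k} converges to a point x^∞ with ∇f(x^∞) = 0. -/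
open scoped RealInnerProductSpace
open Filter

/-- The contraction factor of the prediction-correction step is negative in the admissible range
of `β`. -/
lemma one_sub_two_mul_add_sq_mul_sq_neg {ν β : ℝ} (hν : 0 < ν) (hν1 : ν < 1)
    (hβlo : (1 - Real.sqrt (1 - ν ^ 2)) / ν ^ 2 < β) (hβhi : β ≤ 1) :
    1 - 2 * β + β ^ 2 * ν ^ 2 < 0 := by
  have hs : Real.sqrt (1 - ν ^ 2) ^ 2 = 1 - ν ^ 2 := Real.sq_sqrt (by nlinarith)
  have hs0 : 0 < Real.sqrt (1 - ν ^ 2) := Real.sqrt_pos.2 (by nlinarith)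
  set s := Real.sqrt (1 - ν ^ 2)
  rw [div_lt_iff₀ (by positivity)] at hβlo
  have hupper : β * ν ^ 2 < 1 + s := by nlinarith [sq_nonneg ν]
  have hprod : 0 < (β * ν ^ 2 - (1 - s)) * (1 + s - β * ν ^ 2) :=
    mul_pos (by linarith) (by linarith)
  have hscaled : ν ^ 2 * (1 - 2 * β + β ^ 2 * ν ^ 2) < 0 := by nlinarith
  exact neg_of_mul_neg_right hscaled (sq_nonneg ν)

/-- One prediction-correction step decreases the squared distance to a point `p` with respect to
which the directions `a` (at `x`) and `b` (at the predictor `x - h • a`) are monotone. -/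
lemma norm_sq_correction_step_le {F : Type*} [NormedAddCommGroup F] [InnerProductSpace ℝ F]
    {x p a b : F} {h ν β : ℝ} (hh : 0 ≤ h) (hβ0 : 0 ≤ β) (hβ1 : β ≤ 1)
    (ha : 0 ≤ ⟪a, x - p⟫) (hb : 0 ≤ ⟪b, x - h • a - p⟫) (hab : ‖a - b‖ ≤ ν * ‖a‖) :
    ‖x - h • (a - β • (a - b)) - p‖ ^ 2 ≤
      ‖x - p‖ ^ 2 + h ^ 2 * (1 - 2 * β + β ^ 2 * ν ^ 2) * ‖a‖ ^ 2 := by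
  have hsplit : x - h • (a - β • (a - b)) - p = (x - p) - h • (a - β • (a - b)) := by abel
  have hb' : h * ⟪a, b⟫ ≤ ⟪b, x - p⟫ := by
    have hrw : x - h • a - p = (x - p) - h • a := by abel
    rw [hrw, inner_sub_right, inner_smul_right, real_inner_comm a b] at hb
    linarith
  have hd : ⟪x - p, a - β • (a - b)⟫ = (1 - β) * ⟪a, x - p⟫ + β * ⟪b, x - p⟫ := by
    simp only [inner_sub_right, inner_smul_right, real_inner_comm]
    ring
  have hsq : ‖a - b‖ ^ 2 ≤ ν ^ 2 * ‖a‖ ^ 2 := by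
    rw [← mul_pow]
    exact pow_le_pow_left₀ (norm_nonneg _) hab 2
  have hdn : ‖a - β • (a - b)‖ ^ 2 - 2 * β * ⟪a, b⟫ =
      (1 - 2 * β) * ‖a‖ ^ 2 + β ^ 2 * ‖a - b‖ ^ 2 := by
    rw [norm_sub_sq_real a, inner_smul_right, inner_sub_right, real_inner_self_eq_norm_sq,
      norm_smul, mul_pow, Real.norm_eq_abs, sq_abs]
    ring
  have hdle : ‖a - β • (a - b)‖ ^ 2 - 2 * β * ⟪a, b⟫ ≤
      (1 - 2 * β + β ^ 2 * ν ^ 2) * ‖a‖ ^ 2 := by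
    rw [hdn]
    linarith [mul_le_mul_of_nonneg_left hsq (sq_nonneg β)]
  have hlin : h * (β * (h * ⟪a, b⟫)) ≤ h * ⟪x - p, a - β • (a - b)⟫ := by
    refine mul_le_mul_of_nonneg_left ?_ hh
    rw [hd]
    linarith [mul_nonneg (sub_nonneg.2 hβ1) ha, mul_le_mul_of_nonneg_left hb' hβ0]
  rw [hsplit, norm_sub_sq_real (x - p), inner_smul_right, norm_smul, mul_pow, Real.norm_eq_abs,
    sq_abs]
  linarith [mul_le_mul_of_nonneg_left hdle (sq_nonneg h)]

/-- A sequence that is Fejér monotone with respect to the nonempty zero set of a continuous map `g`,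
with decrease controlled by `‖g (x k)‖ ^ 2`, converges to a zero of `g`. -/
lemma exists_tendsto_zero_of_fejer {E F : Type*} [NormedAddCommGroup E] [ProperSpace E]
    [NormedAddCommGroup F] {g : E → F} (hg : Continuous g) (hX : ∃ p, g p = 0) {x : ℕ → E}
    {c : ℝ} (hc : 0 < c)
    (hx : ∀ p, g p = 0 → ∀ k, ‖x (k + 1) - p‖ ^ 2 + c * ‖g (x k)‖ ^ 2 ≤ ‖x k - p‖ ^ 2) :
    ∃ q, g q = 0 ∧ Tendsto x atTop (nhds q) := by
  have hanti : ∀ p, g p = 0 → Antitone fun k => ‖x k - p‖ ^ 2 := fun p hp =>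
    antitone_nat_of_succ_le fun k => by
      have := hx p hp k
      have : 0 ≤ c * ‖g (x k)‖ ^ 2 := by positivity
      linarith
  obtain ⟨p, hp⟩ := hX
  have hlim := tendsto_atTop_ciInf (hanti p hp)
    ⟨0, by rintro _ ⟨k, rfl⟩; exact sq_nonneg _⟩
  have hdiff := (hlim.sub ((tendsto_add_atTop_iff_nat 1).2 hlim)).div_const c
  rw [sub_self, zero_div] at hdiff
  have hres : Tendsto (fun k => ‖g (x k)‖ ^ 2) atTop (nhds 0) :=
    squeeze_zero (fun k => sq_nonneg _)
      (fun k => by rw [le_div_iff₀ hc]; linarith [hx p hp k]) hdiff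
  have hgx : Tendsto (fun k => g (x k)) atTop (nhds 0) := by
    rw [tendsto_zero_iff_norm_tendsto_zero]
    simpa using hres.sqrt
  have hball : ∀ k, x k ∈ Metric.closedBall p ‖x 0 - p‖ := fun k => by
    rw [mem_closedBall_iff_norm]
    exact (sq_le_sq₀ (norm_nonneg _) (norm_nonneg _)).1 (hanti p hp (Nat.zero_le k))
  obtain ⟨q, -, φ, hφ, hq⟩ := (isCompact_closedBall p ‖x 0 - p‖).tendsto_subseq hball
  have hgq : g q = 0 :=
    tendsto_nhds_unique ((hg.tendsto q).comp hq) (hgx.comp hφ.tendsto_atTop)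
  refine ⟨q, hgq, ?_⟩
  have hsub : Tendsto ((fun k => ‖x k - q‖ ^ 2) ∘ φ) atTop (nhds 0) := by
    simpa [Function.comp_def] using ((tendsto_iff_norm_sub_tendsto_zero.1 hq).pow 2)
  have hfull : Tendsto (fun k => ‖x k - q‖ ^ 2) atTop (nhds 0) :=
    (tendsto_iff_tendsto_subseq_of_antitone (hanti q hgq) hφ.tendsto_atTop).2 hsub
  rw [tendsto_iff_norm_sub_tendsto_zero]
  simpa using hfull.sqrt

/-- Theorem 3.3: global convergence of the adaptive-step improved
prediction-correction algorithm (Algorithm 2). -/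
theorem stmt_8 {n : ℕ} (f : EuclideanSpace ℝ (Fin n) → ℝ)
    (g : EuclideanSpace ℝ (Fin n) → EuclideanSpace ℝ (Fin n))
    (hdiff : ∀ x, HasGradientAt f (g x) x)
    (L : ℝ) (hL : 0 < L)
    (hLip : ∀ x y, ‖g y - g x‖ ≤ L * ‖y - x‖)
    (hpm : ∀ x y, 0 ≤ ⟪g x, y - x⟫ → 0 ≤ ⟪g y, y - x⟫)
    (hX : ∃ xstar, g xstar = 0)
    (ν : ℝ) (hν : 0 < ν) (hν1 : ν < 1)
    (β : ℝ) (hβlo : (1 - Real.sqrt (1 - ν ^ 2)) / ν ^ 2 < β) (hβhi : β ≤ 1)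
    (hmin : ℝ) (hhmin : 0 < hmin)
    (x z : ℕ → EuclideanSpace ℝ (Fin n)) (h : ℕ → ℝ)
    (hhk : ∀ k, hmin ≤ h k)
    (hz : ∀ k, z k = x k - h k • g (x k))
    (hls : ∀ k, h k * ‖g (z k) - g (x k)‖ ≤ ν * ‖z k - x k‖)
    (hx : ∀ k, x (k + 1) = x k - h k • (g (x k) - β • (g (x k) - g (z k)))) :
    ∃ xinf, g xinf = 0 ∧ Tendsto x atTop (nhds xinf) := by
  have hneg := one_sub_two_mul_add_sq_mul_sq_neg hν hν1 hβlo hβhi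
  have hβ0 : 0 ≤ β := by nlinarith [sq_nonneg (β * ν)]
  have hg : Continuous g := (LipschitzWith.of_dist_le_mul (K := ⟨L, hL.le⟩) fun y w => by
    rw [dist_eq_norm, dist_eq_norm]
    exact hLip w y).continuous
  have hmono : ∀ p, g p = 0 → ∀ y, 0 ≤ ⟪g y, y - p⟫ := fun p hp y =>
    hpm p y (by rw [hp, inner_zero_left])
  refine exists_tendsto_zero_of_fejer hg hX
    (c := hmin ^ 2 * -(1 - 2 * β + β ^ 2 * ν ^ 2)) (by have := neg_pos.2 hneg; positivity) ?_
  intro p hp k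
  have hk : 0 < h k := hhmin.trans_le (hhk k)
  have hab : ‖g (x k) - g (z k)‖ ≤ ν * ‖g (x k)‖ := by
    have hzx : ‖z k - x k‖ = h k * ‖g (x k)‖ := by
      rw [hz k, sub_sub_cancel_left, norm_neg, norm_smul, Real.norm_of_nonneg hk.le]
    have hlsk := hls k
    rw [hzx, mul_left_comm, norm_sub_rev] at hlsk
    exact le_of_mul_le_mul_left hlsk hk
  have hb : 0 ≤ ⟪g (z k), x k - h k • g (x k) - p⟫ := by
    rw [← hz k]
    exact hmono p hp (z k)
  have hstep := norm_sq_correction_step_le hk.le hβ0 hβhi (hmono p hp (x k)) hb hab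
  rw [← hx k] at hstep
  have hsq : hmin ^ 2 ≤ h k ^ 2 := pow_le_pow_left₀ hhmin.le (hhk k) 2
  have := mul_le_mul_of_nonneg_right hsq
    (mul_nonneg (neg_pos.2 hneg).le (sq_nonneg ‖g (x k)‖))
  linarith
end

section
/- Let f : ℝ^n → ℝ be a differentiable convex function with L-Lipschitz continuous gradient ∇f (L > 0), and let x* be a minimizer of f, so ∇f(x*) = 0. Given a point x and step size h > 0, let z = x - h∇f(x). Then ⟨x - x*, h∇f(x)⟩ ≥ (1 - Lh/4)‖x - z‖². -/
open scoped RealInnerProductSpace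

section Cocoercivity

variable {E : Type*} [NormedAddCommGroup E] [InnerProductSpace ℝ E] [CompleteSpace E]
  {f : E → ℝ} {g : E → E} {L : ℝ}

/-- The descent lemma: a function with `L`-Lipschitz gradient lies below its quadratic model. -/
theorem le_add_inner_add_sq_of_lipschitz_gradient
    (hdiff : ∀ x, HasGradientAt f (g x) x) (hLip : ∀ x y, ‖g y - g x‖ ≤ L * ‖y - x‖) (x y : E) :
    f y ≤ f x + ⟪g x, y - x⟫ + L / 2 * ‖y - x‖ ^ 2 := by
  set d := y - x with hd
  have hderiv (t : ℝ) :
      HasDerivAt (fun t : ℝ => f (x + t • d) - (t * ⟪g x, d⟫ + L / 2 * ‖d‖ ^ 2 * t ^ 2))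
        (⟪g (x + t • d), d⟫ - (⟪g x, d⟫ + L * ‖d‖ ^ 2 * t)) t := by
    have hline : HasDerivAt (fun t : ℝ => x + t • d) d t := by
      simpa using ((hasDerivAt_id t).smul_const d).const_add x
    have hcomp := (hdiff (x + t • d)).hasFDerivAt.comp_hasDerivAt t hline
    have hquad := ((hasDerivAt_id t).mul_const ⟪g x, d⟫).add
      (((hasDerivAt_id t).pow 2).const_mul (L / 2 * ‖d‖ ^ 2))
    refine (hcomp.sub hquad).congr_deriv ?_
    simp
    ring
  have hanti := antitoneOn_of_deriv_nonpos (convex_Icc (0 : ℝ) 1)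
    (fun t _ => (hderiv t).continuousAt.continuousWithinAt)
    (fun t _ => (hderiv t).differentiableAt.differentiableWithinAt) (fun t ht => by
      rw [interior_Icc] at ht
      rw [(hderiv t).deriv]
      have hcs := real_inner_le_norm (g (x + t • d) - g x) d
      have hbound := hLip x (x + t • d)
      rw [add_sub_cancel_left, norm_smul, Real.norm_of_nonneg ht.1.le] at hbound
      rw [inner_sub_left] at hcs
      nlinarith [mul_le_mul_of_nonneg_right hbound (norm_nonneg d)])
  have h01 := hanti (Set.left_mem_Icc.2 zero_le_one) (Set.right_mem_Icc.2 zero_le_one) zero_le_one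
  have hy : x + d = y := add_sub_cancel x y
  simp only [one_smul, zero_smul, add_zero, hy] at h01
  linarith

/-- A convex function with `L`-Lipschitz gradient exceeds its tangent planes by a multiple of the
squared gradient difference. -/
theorem add_inner_add_sq_gradient_sub_le
    (hdiff : ∀ x, HasGradientAt f (g x) x) (hconv : ∀ x y, f x + ⟪g x, y - x⟫ ≤ f y)
    (hL : 0 < L) (hLip : ∀ x y, ‖g y - g x‖ ≤ L * ‖y - x‖) (x y : E) :
    f x + ⟪g x, y - x⟫ + ‖g y - g x‖ ^ 2 / (2 * L) ≤ f y := by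
  set u := g y - g x with hu
  have hlower := hconv x (y - L⁻¹ • u)
  have hupper := le_add_inner_add_sq_of_lipschitz_gradient hdiff hLip y (y - L⁻¹ • u)
  have hnorm : ⟪g y, u⟫ - ⟪g x, u⟫ = ‖u‖ ^ 2 := by
    rw [← inner_sub_left, ← hu, real_inner_self_eq_norm_sq]
  rw [sub_right_comm, inner_sub_right, real_inner_smul_right] at hlower
  rw [sub_sub_cancel_left, inner_neg_right, real_inner_smul_right, norm_neg, norm_smul,
    Real.norm_of_nonneg (inv_nonneg.2 hL.le)] at hupper
  have hquad : L / 2 * (L⁻¹ * ‖u‖) ^ 2 = L⁻¹ * ‖u‖ ^ 2 - ‖u‖ ^ 2 / (2 * L) := by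
    field_simp
    ring
  rw [hquad, ← hnorm] at hupper
  rw [← hnorm]
  linarith

/-- Cocoercivity of the Lipschitz gradient of a convex function (Baillon–Haddad). -/
theorem sq_gradient_sub_le_mul_inner
    (hdiff : ∀ x, HasGradientAt f (g x) x) (hconv : ∀ x y, f x + ⟪g x, y - x⟫ ≤ f y)
    (hL : 0 < L) (hLip : ∀ x y, ‖g y - g x‖ ≤ L * ‖y - x‖) (x y : E) :
    ‖g x - g y‖ ^ 2 ≤ L * ⟪x - y, g x - g y⟫ := by
  have hxy := add_inner_add_sq_gradient_sub_le hdiff hconv hL hLip x y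
  have hyx := add_inner_add_sq_gradient_sub_le hdiff hconv hL hLip y x
  rw [norm_sub_rev, ← neg_sub x y, inner_neg_right] at hxy
  have hsum : ‖g x - g y‖ ^ 2 / L ≤ ⟪x - y, g x - g y⟫ := by
    rw [real_inner_comm, inner_sub_left]
    have hhalf : ‖g x - g y‖ ^ 2 / L = 2 * (‖g x - g y‖ ^ 2 / (2 * L)) := by
      field_simp
    linarith
  rwa [div_le_iff₀' hL] at hsum

end Cocoercivity

/-- Inequality (3.8) in the proof of Lemma 3.4: cocoercivity-based bound
⟨x - x*, h∇f(x)⟩ ≥ (1 - Lh/4)‖x - z‖². -/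
theorem stmt_10 {n : ℕ} (f : EuclideanSpace ℝ (Fin n) → ℝ)
    (g : EuclideanSpace ℝ (Fin n) → EuclideanSpace ℝ (Fin n))
    (hdiff : ∀ x, HasGradientAt f (g x) x)
    (hconv : ∀ x y, f x + ⟪g x, y - x⟫ ≤ f y)
    (L : ℝ) (hL : 0 < L)
    (hLip : ∀ x y, ‖g y - g x‖ ≤ L * ‖y - x‖)
    (xstar : EuclideanSpace ℝ (Fin n)) (hmin : ∀ y, f xstar ≤ f y)
    (hstar : g xstar = 0)
    (x z : EuclideanSpace ℝ (Fin n)) (h : ℝ) (hh : 0 < h)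
    (hz : z = x - h • g x) :
    (1 - L * h / 4) * ‖x - z‖ ^ 2 ≤ ⟪x - xstar, h • g x⟫ := by
  have hcoco := sq_gradient_sub_le_mul_inner hdiff hconv hL hLip x xstar
  rw [hstar, sub_zero] at hcoco
  rw [hz, sub_sub_cancel, norm_smul, Real.norm_of_nonneg hh.le, real_inner_smul_right]
  have hscalar : (1 - L * h / 4) * (L * h) ≤ 1 := by
    nlinarith [sq_nonneg (L * h - 2)]
  refine le_of_mul_le_mul_left ?_ hL
  calc L * ((1 - L * h / 4) * (h * ‖g x‖) ^ 2)
      = (1 - L * h / 4) * (L * h) * (h * ‖g x‖ ^ 2) := by ring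
    _ ≤ 1 * (h * ‖g x‖ ^ 2) := by gcongr
    _ = h * ‖g x‖ ^ 2 := one_mul _
    _ ≤ h * (L * ⟪x - xstar, g x⟫) := by gcongr
    _ = L * (h * ⟪x - xstar, g x⟫) := by ring
end

section
/- Let f : ℝ^n → ℝ be a differentiable convex function with L-Lipschitz continuous gradient ∇f (L > 0). Let 0 ≤ β ≤ 1, 0 < ν < 1, and let h̄ satisfy 0 < h̄ < 4/L. Given a point x with ∇f(x) ≠ 0 and a step size h with 0 < h ≤ h̄, let z = x - h∇f(x), assume the line search condition h‖∇f(x) - ∇f(z)‖ ≤ ν‖x - z‖ holds, and define α = ((1 - β)(1 - Lh/4)‖x - z‖² + β⟨x - z, h∇f(z)⟩) / (h²‖∇f(x) - β(∇f(x) - ∇f(z))‖²). Then α ≥ ((1 - β)(1 - Lh̄/4) + β(1 - ν)) / (2 + 2β²ν²). -/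
open scoped RealInnerProductSpace

/-- For a perturbation `w` with `‖w‖ ≤ ν * ‖u‖`, the inner product of `u` with `u - w` is at
least `(1 - ν) * ‖u‖ ^ 2`. -/
theorem one_sub_mul_norm_sq_le_inner_sub {E : Type*} [NormedAddCommGroup E]
    [InnerProductSpace ℝ E] {u w : E} {ν : ℝ} (hw : ‖w‖ ≤ ν * ‖u‖) :
    (1 - ν) * ‖u‖ ^ 2 ≤ ⟪u, u - w⟫ := by
  rw [inner_sub_right, real_inner_self_eq_norm_sq]
  nlinarith [real_inner_le_norm u w, mul_le_mul_of_nonneg_left hw (norm_nonneg u)]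

theorem norm_sub_smul_sq_le {E : Type*} [NormedAddCommGroup E]
    [InnerProductSpace ℝ E] {u w : E} {ν : ℝ} (hw : ‖w‖ ≤ ν * ‖u‖) (β : ℝ) :
    ‖u - β • w‖ ^ 2 ≤ (2 + 2 * β ^ 2 * ν ^ 2) * ‖u‖ ^ 2 := by
  have hpar := parallelogram_law_with_norm ℝ u (β • w)
  have hsq : ‖β • w‖ ^ 2 = β ^ 2 * ‖w‖ ^ 2 := by
    rw [norm_smul, mul_pow, Real.norm_eq_abs, sq_abs]
  have hw2 : ‖w‖ ^ 2 ≤ (ν * ‖u‖) ^ 2 := by gcongr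
  nlinarith [mul_self_nonneg ‖u + β • w‖, mul_le_mul_of_nonneg_left hw2 (sq_nonneg β)]

theorem norm_sub_smul_pos {E : Type*} [NormedAddCommGroup E] [NormedSpace ℝ E]
    {u w : E} {β ν : ℝ} (hu : u ≠ 0) (hw : ‖w‖ ≤ ν * ‖u‖) (hβ0 : 0 ≤ β) (hβν : β * ν < 1) :
    0 < ‖u - β • w‖ := by
  have hbound : ‖β • w‖ ≤ β * (ν * ‖u‖) := by
    rw [norm_smul, Real.norm_of_nonneg hβ0]
    gcongr
  have hlt : β * ν * ‖u‖ < 1 * ‖u‖ := by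
    have := norm_pos_iff.mpr hu
    gcongr
  linarith [norm_sub_norm_le u (β • w)]

/-- Lemma 3.5: the correction step length α of Algorithm 3 is uniformly bounded
below by α_min = ((1 - β)(1 - Lh̄/4) + β(1 - ν))/(2 + 2β²ν²). -/
theorem stmt_13 {n : ℕ} (f : EuclideanSpace ℝ (Fin n) → ℝ)
    (g : EuclideanSpace ℝ (Fin n) → EuclideanSpace ℝ (Fin n))
    (hdiff : ∀ x, HasGradientAt f (g x) x)
    (hconv : ∀ x y, f x + ⟪g x, y - x⟫ ≤ f y)
    (L : ℝ) (hL : 0 < L)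
    (hLip : ∀ x y, ‖g y - g x‖ ≤ L * ‖y - x‖)
    (β ν hbar : ℝ) (hβ0 : 0 ≤ β) (hβ1 : β ≤ 1) (hν : 0 < ν) (hν1 : ν < 1)
    (hbar0 : 0 < hbar) (hbarL : hbar < 4 / L)
    (x z : EuclideanSpace ℝ (Fin n)) (hx : g x ≠ 0)
    (h : ℝ) (hh0 : 0 < h) (hhbar : h ≤ hbar)
    (hz : z = x - h • g x)
    (hls : h * ‖g x - g z‖ ≤ ν * ‖x - z‖)
    (α : ℝ)
    (hα : α = ((1 - β) * (1 - L * h / 4) * ‖x - z‖ ^ 2 + β * ⟪x - z, h • g z⟫) /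
        (h ^ 2 * ‖g x - β • (g x - g z)‖ ^ 2)) :
    ((1 - β) * (1 - L * hbar / 4) + β * (1 - ν)) / (2 + 2 * β ^ 2 * ν ^ 2) ≤ α := by
  set u := h • g x with hu
  set w := h • (g x - g z) with hw
  have hxz : x - z = u := by rw [hz, sub_sub_cancel]
  have hgz : h • g z = u - w := by rw [hu, hw, smul_sub, sub_sub_cancel]
  have hwu : ‖w‖ ≤ ν * ‖u‖ := by
    rw [hw, norm_smul, Real.norm_of_nonneg hh0.le, ← hxz]
    exact hls
  have hden : h ^ 2 * ‖g x - β • (g x - g z)‖ ^ 2 = ‖u - β • w‖ ^ 2 := by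
    rw [hu, hw, smul_comm β h, ← smul_sub, norm_smul, mul_pow, Real.norm_of_nonneg hh0.le]
  have hu0 : u ≠ 0 := smul_ne_zero hh0.ne' hx
  have hpos := norm_sub_smul_pos hu0 hwu hβ0 (mul_lt_one_of_nonneg_of_lt_one_right hβ1 hν.le hν1)
  have hLh : L * h ≤ L * hbar := by gcongr
  have hLbar : hbar * L < 4 := (lt_div_iff₀ hL).mp hbarL
  have hnum : ((1 - β) * (1 - L * hbar / 4) + β * (1 - ν)) * ‖u‖ ^ 2 ≤
      (1 - β) * (1 - L * h / 4) * ‖u‖ ^ 2 + β * ⟪u, u - w⟫ := by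
    have hstep : (1 - β) * (1 - L * hbar / 4) * ‖u‖ ^ 2 ≤
        (1 - β) * (1 - L * h / 4) * ‖u‖ ^ 2 := by
      have : 0 ≤ 1 - β := by linarith
      gcongr
    have hinner := mul_le_mul_of_nonneg_left (one_sub_mul_norm_sq_le_inner_sub hwu) hβ0
    linarith
  have hnonneg : 0 ≤ (1 - β) * (1 - L * hbar / 4) + β * (1 - ν) :=
    add_nonneg (mul_nonneg (by linarith) (by linarith)) (mul_nonneg hβ0 (by linarith))
  rw [hα, hden, hxz, hgz, div_le_div_iff₀ (by positivity) (by positivity)]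
  calc
    _ ≤ ((1 - β) * (1 - L * hbar / 4) + β * (1 - ν)) *
        ((2 + 2 * β ^ 2 * ν ^ 2) * ‖u‖ ^ 2) := by
      gcongr
      exact norm_sub_smul_sq_le hwu β
    _ = ((1 - β) * (1 - L * hbar / 4) + β * (1 - ν)) * ‖u‖ ^ 2 *
        (2 + 2 * β ^ 2 * ν ^ 2) := by ring
    _ ≤ _ := by gcongr
end

section
/- Let f : ℝ^n → ℝ be a differentiable convex function with L-Lipschitz continuous gradient ∇f (L > 0), and let x* be a minimizer of f, so ∇f(x*) = 0. Let 0 ≤ β ≤ 1, 0 < ν < 1, η ∈ (0,2), and 0 < h̄ < 4/L. Given a point x with ∇f(x) ≠ 0 and a step size h with 0 < h ≤ h̄, let z = x - h∇f(x), assume the line search condition h‖∇f(x) - ∇f(z)‖ ≤ ν‖x - z‖, define d = h(∇f(x) - β(∇f(x) - ∇f(z))), α = ((1 - β)(1 - Lh/4)‖x - z‖² + β⟨x - z, h∇f(z)⟩)/(h²‖∇f(x) - β(∇f(x) - ∇f(z))‖²), and x⁺ = x - ηα·d. Then with α_min = ((1 - β)(1 - Lh̄/4) + β(1 - ν))/(2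 + 2β²ν²) and κ₄ = η(2 - η)·α_min·((1 - β)(1 - Lh̄/4) + β(1 - ν)), one has ‖x⁺ - x*‖² ≤ ‖x - x*‖² - κ₄‖x - z‖², and κ₄ > 0. -/
open scoped RealInnerProductSpace

/-- The descent lemma for a function with Lipschitz continuous gradient. -/
lemma descent_of_lipschitz_gradient {E : Type*} [NormedAddCommGroup E]
    [InnerProductSpace ℝ E] [CompleteSpace E] {f : E → ℝ} {g : E → E} {L : ℝ}
    (hdiff : ∀ x, HasGradientAt f (g x) x)
    (hLip : ∀ x y, ‖g y - g x‖ ≤ L * ‖y - x‖) (x v : E) :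
    f (x + v) ≤ f x + ⟪g x, v⟫ + L / 2 * ‖v‖ ^ 2 := by
  have hder (t : ℝ) : HasDerivAt
      (fun t : ℝ => f (x + t • v) - (t * ⟪g x, v⟫ + L / 2 * ‖v‖ ^ 2 * t ^ 2))
      (⟪g (x + t • v), v⟫ - (⟪g x, v⟫ + L * ‖v‖ ^ 2 * t)) t := by
    have hline : HasDerivAt (fun t : ℝ => x + t • v) v t := by
      simpa using ((hasDerivAt_id t).smul_const v).const_add x
    have hf := (hdiff (x + t • v)).hasFDerivAt.comp_hasDerivAt t hline
    have hq := ((hasDerivAt_id t).mul_const ⟪g x, v⟫).add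
      (((hasDerivAt_id t).pow 2).const_mul (L / 2 * ‖v‖ ^ 2))
    refine (hf.sub hq).congr_deriv ?_
    simp only [InnerProductSpace.toDual_apply_apply, id_eq]
    norm_num
    ring
  have hanti : AntitoneOn
      (fun t : ℝ => f (x + t • v) - (t * ⟪g x, v⟫ + L / 2 * ‖v‖ ^ 2 * t ^ 2)) (Set.Icc 0 1) := by
    refine antitoneOn_of_deriv_nonpos (convex_Icc 0 1)
      (fun t _ => (hder t).continuousAt.continuousWithinAt)
      (fun t _ => (hder t).differentiableAt.differentiableWithinAt) fun t ht => ?_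
    rw [interior_Icc] at ht
    rw [(hder t).deriv, ← sub_sub, ← inner_sub_left, sub_nonpos]
    calc ⟪g (x + t • v) - g x, v⟫ ≤ ‖g (x + t • v) - g x‖ * ‖v‖ := real_inner_le_norm _ _
      _ ≤ L * ‖x + t • v - x‖ * ‖v‖ := by gcongr; exact hLip _ _
      _ = L * ‖v‖ ^ 2 * t := by
        rw [add_sub_cancel_left, norm_smul, Real.norm_of_nonneg ht.1.le]
        ring
  have h01 := hanti (Set.left_mem_Icc.2 zero_le_one) (Set.right_mem_Icc.2 zero_le_one) zero_le_one
  simp only [one_smul, zero_smul, add_zero] at h01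
  linarith

/-- Cocoercivity of the gradient of a smooth convex function relative to a minimizer. -/
lemma norm_sq_gradient_le_of_isMin {E : Type*} [NormedAddCommGroup E]
    [InnerProductSpace ℝ E] [CompleteSpace E] {f : E → ℝ} {g : E → E} {L : ℝ}
    (hdiff : ∀ x, HasGradientAt f (g x) x)
    (hconv : ∀ x y, f x + ⟪g x, y - x⟫ ≤ f y) (hL : 0 < L)
    (hLip : ∀ x y, ‖g y - g x‖ ≤ L * ‖y - x‖) {a : E} (hmin : ∀ y, f a ≤ f y)
    (ha : g a = 0) (x : E) : ‖g x‖ ^ 2 ≤ L * ⟪x - a, g x⟫ := by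
  have hdesc := (hmin _).trans (descent_of_lipschitz_gradient hdiff hLip x (-(L⁻¹ • g x)))
  have hupper := (hconv x _).trans (descent_of_lipschitz_gradient hdiff hLip a (L⁻¹ • g x))
  have hsplit : a + L⁻¹ • g x - x = L⁻¹ • g x - (x - a) := by abel
  rw [hsplit] at hupper
  simp only [ha, inner_neg_right, inner_sub_right, real_inner_smul_right, inner_zero_left,
    real_inner_self_eq_norm_sq, norm_neg, norm_smul, Real.norm_of_nonneg (inv_pos.2 hL).le,
    mul_pow] at hdesc hupper
  rw [real_inner_comm, inner_sub_right]
  have hhalf : L / 2 * (L⁻¹ ^ 2 * ‖g x‖ ^ 2) = L⁻¹ * ‖g x‖ ^ 2 / 2 := by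
    field_simp
  have hinv : L⁻¹ * ‖g x‖ ^ 2 ≤ ⟪g x, x⟫ - ⟪g x, a⟫ := by linarith
  rwa [inv_mul_le_iff₀ hL] at hinv

/-- Cocoercivity relative to a minimizer, for the displacement of a gradient step. -/
lemma norm_sq_gradient_step_le_of_isMin {E : Type*} [NormedAddCommGroup E]
    [InnerProductSpace ℝ E] [CompleteSpace E] {f : E → ℝ} {g : E → E} {L : ℝ}
    (hdiff : ∀ x, HasGradientAt f (g x) x)
    (hconv : ∀ x y, f x + ⟪g x, y - x⟫ ≤ f y) (hL : 0 < L)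
    (hLip : ∀ x y, ‖g y - g x‖ ≤ L * ‖y - x‖) {a : E} (hmin : ∀ y, f a ≤ f y)
    (ha : g a = 0) (x : E) {h : ℝ} (hh : 0 < h) :
    (1 - L * h / 4) * ‖h • g x‖ ^ 2 ≤ ⟪x - a, h • g x⟫ := by
  have hco := norm_sq_gradient_le_of_isMin hdiff hconv hL hLip hmin ha x
  rw [norm_smul, real_inner_smul_right, mul_pow, Real.norm_of_nonneg hh.le]
  have hquad : L * h * (1 - L * h / 4) ≤ 1 := by nlinarith [sq_nonneg (L * h / 2 - 1)]
  have hscaled := mul_le_mul_of_nonneg_right hquad (sq_nonneg ‖g x‖)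
  refine le_of_mul_le_mul_left ?_ (div_pos hL hh)
  calc L / h * ((1 - L * h / 4) * (h ^ 2 * ‖g x‖ ^ 2))
      = L * h * (1 - L * h / 4) * ‖g x‖ ^ 2 := by field_simp
    _ ≤ L * ⟪x - a, g x⟫ := by linarith
    _ = L / h * (h * ⟪x - a, g x⟫) := by field_simp

/-- The gradient of a convex function at `z` makes an acute angle with the direction from a
minimizer to `z`. -/
lemma inner_sub_gradient_le_of_isMin {E : Type*} [NormedAddCommGroup E] [InnerProductSpace ℝ E]
    {f : E → ℝ} {g : E → E} (hconv : ∀ x y, f x + ⟪g x, y - x⟫ ≤ f y) {a : E}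
    (hmin : ∀ y, f a ≤ f y) (x z : E) : ⟪x - z, g z⟫ ≤ ⟪x - a, g z⟫ := by
  have hza : ⟪g z, a - z⟫ ≤ 0 := by linarith [hconv z a, hmin z]
  rw [← sub_add_sub_cancel x a z, inner_add_left, real_inner_comm (g z) (a - z)]
  linarith

/-- One relaxed step along a direction that separates `x` from `a`. -/
lemma norm_sq_relaxed_step_le {E : Type*} [NormedAddCommGroup E] [InnerProductSpace ℝ E]
    {x a d : E} {φ α η : ℝ} (hη : 0 ≤ η) (hα : 0 ≤ α)
    (hφ : φ ≤ ⟪x - a, d⟫) (hαd : α * ‖d‖ ^ 2 = φ) :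
    ‖x - (η * α) • d - a‖ ^ 2 ≤ ‖x - a‖ ^ 2 - η * (2 - η) * (α * φ) := by
  rw [sub_right_comm, norm_sub_sq_real, real_inner_smul_right, norm_smul, mul_pow,
    Real.norm_eq_abs, sq_abs]
  have hsq : (η * α) ^ 2 * ‖d‖ ^ 2 = η ^ 2 * (α * φ) := by rw [← hαd]; ring
  have hmul := mul_le_mul_of_nonneg_left hφ (mul_nonneg hη hα)
  rw [hsq]
  linarith

/-- Proposition 3.3: single-iteration Fejér monotonicity estimate for the improved
prediction-correction algorithm for convex problems (Algorithm 3). -/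
theorem stmt_14 {n : ℕ} (f : EuclideanSpace ℝ (Fin n) → ℝ)
    (g : EuclideanSpace ℝ (Fin n) → EuclideanSpace ℝ (Fin n))
    (hdiff : ∀ x, HasGradientAt f (g x) x)
    (hconv : ∀ x y, f x + ⟪g x, y - x⟫ ≤ f y)
    (L : ℝ) (hL : 0 < L)
    (hLip : ∀ x y, ‖g y - g x‖ ≤ L * ‖y - x‖)
    (xstar : EuclideanSpace ℝ (Fin n)) (hmin : ∀ y, f xstar ≤ f y)
    (hstar : g xstar = 0)
    (β ν η hbar : ℝ) (hβ0 : 0 ≤ β) (hβ1 : β ≤ 1) (hν : 0 < ν) (hν1 : ν < 1)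
    (hη0 : 0 < η) (hη2 : η < 2) (hbar0 : 0 < hbar) (hbarL : hbar < 4 / L)
    (x z xp d : EuclideanSpace ℝ (Fin n)) (hx : g x ≠ 0)
    (h : ℝ) (hh0 : 0 < h) (hhbar : h ≤ hbar)
    (hz : z = x - h • g x)
    (hls : h * ‖g x - g z‖ ≤ ν * ‖x - z‖)
    (hd : d = h • (g x - β • (g x - g z)))
    (α : ℝ)
    (hα : α = ((1 - β) * (1 - L * h / 4) * ‖x - z‖ ^ 2 + β * ⟪x - z, h • g z⟫) /
        (h ^ 2 * ‖g x - β • (g x - g z)‖ ^ 2))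
    (hxp : xp = x - (η * α) • d)
    (αmin κ₄ : ℝ)
    (hαmin : αmin = ((1 - β) * (1 - L * hbar / 4) + β * (1 - ν)) / (2 + 2 * β ^ 2 * ν ^ 2))
    (hκ : κ₄ = η * (2 - η) * αmin * ((1 - β) * (1 - L * hbar / 4) + β * (1 - ν))) :
    ‖xp - xstar‖ ^ 2 ≤ ‖x - xstar‖ ^ 2 - κ₄ * ‖x - z‖ ^ 2 ∧ 0 < κ₄ := by
  have hu : x - z = h • g x := by rw [hz, sub_sub_cancel]
  set w := h • (g x - g z) with hw
  have hhgz : h • g z = (x - z) - w := by rw [hu, hw, smul_sub, sub_sub_cancel]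
  have hdw : d = (x - z) - β • w := by rw [hd, hu, hw, smul_sub, smul_comm h β]
  have hwn : ‖w‖ ≤ ν * ‖x - z‖ := by rwa [hw, norm_smul, Real.norm_of_nonneg hh0.le]
  have hN : 0 < ‖x - z‖ := by
    rw [hu]
    exact norm_pos_iff.2 (smul_ne_zero hh0.ne' hx)
  have hden : h ^ 2 * ‖g x - β • (g x - g z)‖ ^ 2 = ‖d‖ ^ 2 := by
    rw [hd, norm_smul, mul_pow, Real.norm_of_nonneg hh0.le]
  rw [hden] at hα
  set φ := (1 - β) * (1 - L * h / 4) * ‖x - z‖ ^ 2 + β * ⟪x - z, h • g z⟫ with hφdef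
  set c := (1 - β) * (1 - L * hbar / 4) + β * (1 - ν) with hc
  have hβ1' : 0 ≤ 1 - β := by linarith
  have hc0 : 0 < c := by
    have hs : 0 < 1 - L * hbar / 4 := by
      have := (lt_div_iff₀' hL).1 hbarL
      linarith
    rcases hβ0.eq_or_lt with rfl | hβ
    · simpa [hc] using hs
    · exact add_pos_of_nonneg_of_pos (mul_nonneg hβ1' hs.le) (mul_pos hβ (by linarith))
  have hβw : ‖β • w‖ ≤ β * (ν * ‖x - z‖) := by
    rw [norm_smul, Real.norm_of_nonneg hβ0]
    gcongr
  have hd0 : 0 < ‖d‖ := by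
    have htri : ‖x - z‖ - ‖β • w‖ ≤ ‖d‖ := hdw ▸ norm_sub_norm_le _ _
    have : β * (ν * ‖x - z‖) ≤ ν * ‖x - z‖ := mul_le_of_le_one_left (by positivity) hβ1
    have : ν * ‖x - z‖ < ‖x - z‖ := mul_lt_of_lt_one_left hN hν1
    linarith
  have hdle : ‖d‖ ^ 2 ≤ (2 + 2 * β ^ 2 * ν ^ 2) * ‖x - z‖ ^ 2 := by
    have hsum : ‖d‖ ≤ ‖x - z‖ + β * (ν * ‖x - z‖) := by
      rw [hdw]
      exact (norm_sub_le _ _).trans (by gcongr)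
    have hsq : ‖d‖ ^ 2 ≤ (‖x - z‖ + β * (ν * ‖x - z‖)) ^ 2 := by gcongr
    nlinarith [sq_nonneg (‖x - z‖ - β * (ν * ‖x - z‖))]
  have hφc : c * ‖x - z‖ ^ 2 ≤ φ := by
    have hinner : (1 - ν) * ‖x - z‖ ^ 2 ≤ ⟪x - z, h • g z⟫ := by
      rw [hhgz, inner_sub_right, real_inner_self_eq_norm_sq]
      have := real_inner_le_norm (x - z) w
      have := mul_le_mul_of_nonneg_left hwn hN.le
      linarith
    have hstep : 1 - L * hbar / 4 ≤ 1 - L * h / 4 := by gcongr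
    calc c * ‖x - z‖ ^ 2
        = (1 - β) * (1 - L * hbar / 4) * ‖x - z‖ ^ 2 + β * ((1 - ν) * ‖x - z‖ ^ 2) := by
          rw [hc]; ring
      _ ≤ φ := by rw [hφdef]; gcongr
  have hsep : φ ≤ ⟪x - xstar, d⟫ := by
    have hx' : (1 - L * h / 4) * ‖x - z‖ ^ 2 ≤ ⟪x - xstar, x - z⟫ :=
      hu ▸ norm_sq_gradient_step_le_of_isMin hdiff hconv hL hLip hmin hstar x hh0
    have hz' : ⟪x - z, h • g z⟫ ≤ ⟪x - xstar, h • g z⟫ := by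
      rw [real_inner_smul_right, real_inner_smul_right]
      gcongr
      exact inner_sub_gradient_le_of_isMin hconv hmin x z
    have hd' : d = (1 - β) • (x - z) + β • (h • g z) := by
      rw [hdw, hhgz]; module
    rw [hd', inner_add_right, real_inner_smul_right, real_inner_smul_right, hφdef, mul_assoc]
    gcongr
  have hφ0 : 0 < φ := lt_of_lt_of_le (by positivity) hφc
  have hα0 : 0 ≤ α := by rw [hα]; positivity
  have hαd : α * ‖d‖ ^ 2 = φ := by rw [hα]; field_simp
  have hαmin0 : 0 < αmin := by rw [hαmin]; positivity
  have hαle : αmin ≤ α := by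
    rw [hα, hαmin, div_le_div_iff₀ (by positivity) (by positivity)]
    calc c * ‖d‖ ^ 2 ≤ c * ((2 + 2 * β ^ 2 * ν ^ 2) * ‖x - z‖ ^ 2) := by gcongr
      _ = c * ‖x - z‖ ^ 2 * (2 + 2 * β ^ 2 * ν ^ 2) := by ring
      _ ≤ φ * (2 + 2 * β ^ 2 * ν ^ 2) := by gcongr
  have hη : 0 < η * (2 - η) := mul_pos hη0 (by linarith)
  refine ⟨?_, by rw [hκ]; positivity⟩
  rw [hxp]
  refine (norm_sq_relaxed_step_le hη0.le hα0 hsep hαd).trans (sub_le_sub_left ?_ _)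
  calc κ₄ * ‖x - z‖ ^ 2 = η * (2 - η) * (αmin * (c * ‖x - z‖ ^ 2)) := by rw [hκ]; ring
    _ ≤ η * (2 - η) * (α * φ) := by gcongr
end

section
/- Let f : ℝ^n → ℝ be a differentiable convex function with L-Lipschitz continuous gradient ∇f (L > 0), and let x* be a minimizer of f, so ∇f(x*) = 0. Let 0 ≤ β ≤ 1 and let h = 0.9/L. Given a point x with ∇f(x) ≠ 0, let z = x - h∇f(x) and define α = ((1 - β)(1 - Lh/4)‖x - z‖² + β⟨x - z, h∇f(z)⟩)/(h²‖∇f(x) - β(∇f(x) - ∇f(z))‖²). Then α > 1/2. -/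
open scoped RealInnerProductSpace

/-- Subsection 3.3: with prediction step size h = 0.9/L, the adaptive correction
step length α of Algorithm 3 exceeds 1/2. -/
theorem stmt_17 {n : ℕ} (f : EuclideanSpace ℝ (Fin n) → ℝ)
    (g : EuclideanSpace ℝ (Fin n) → EuclideanSpace ℝ (Fin n))
    (hdiff : ∀ x, HasGradientAt f (g x) x)
    (hconv : ∀ x y, f x + ⟪g x, y - x⟫ ≤ f y)
    (L : ℝ) (hL : 0 < L)
    (hLip : ∀ x y, ‖g y - g x‖ ≤ L * ‖y - x‖)
    (xstar : EuclideanSpace ℝ (Fin n)) (hmin : ∀ y, f xstar ≤ f y)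
    (hstar : g xstar = 0)
    (β : ℝ) (hβ0 : 0 ≤ β) (hβ1 : β ≤ 1)
    (h : ℝ) (hh : h = 0.9 / L)
    (x z : EuclideanSpace ℝ (Fin n)) (hx : g x ≠ 0)
    (hz : z = x - h • g x)
    (α : ℝ)
    (hα : α = ((1 - β) * (1 - L * h / 4) * ‖x - z‖ ^ 2 + β * ⟪x - z, h • g z⟫) /
        (h ^ 2 * ‖g x - β • (g x - g z)‖ ^ 2)) :
    1 / 2 < α := by
  have hh0 : 0 < h := by rw [hh]; positivity
  have hLh : L * h = 0.9 := by rw [hh]; field_simp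
  have hxz : x - z = h • g x := by rw [hz]; abel
  have ha : 0 < ‖g x‖ := norm_pos_iff.mpr hx
  obtain ⟨d, hd⟩ : ∃ d, d = g x - g z := ⟨_, rfl⟩
  have hgz : g z = g x - d := by rw [hd]; abel
  have hdle : ‖d‖ ≤ 0.9 * ‖g x‖ := by
    have := hLip z x
    rwa [← hd, hxz, norm_smul, Real.norm_of_nonneg hh0.le, ← mul_assoc, hLh] at this
  have hpos : 0 < ‖g x - β • d‖ := by
    have h1 := norm_sub_norm_le (g x) (β • d)
    rw [norm_smul, Real.norm_of_nonneg hβ0] at h1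
    have h2 := mul_le_of_le_one_left (norm_nonneg d) hβ1
    linarith
  have hsq : ‖d‖ ^ 2 ≤ 0.81 * ‖g x‖ ^ 2 := by
    nlinarith [pow_le_pow_left₀ (norm_nonneg d) hdle 2]
  have hnum : (1 - β) * (1 - L * h / 4) * ‖x - z‖ ^ 2 + β * ⟪x - z, h • g z⟫ =
      h ^ 2 * ((1 - β) * 0.775 * ‖g x‖ ^ 2 + β * (‖g x‖ ^ 2 - ⟪g x, d⟫)) := by
    rw [hxz, hLh, hgz, norm_smul, Real.norm_of_nonneg hh0.le, real_inner_smul_left,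
      real_inner_smul_right, inner_sub_right, real_inner_self_eq_norm_sq]
    ring
  have hden : ‖g x - β • d‖ ^ 2 = ‖g x‖ ^ 2 - 2 * β * ⟪g x, d⟫ + β ^ 2 * ‖d‖ ^ 2 := by
    rw [norm_sub_sq_real, norm_smul, Real.norm_of_nonneg hβ0, real_inner_smul_right]
    ring
  have key : β ^ 2 * ‖d‖ ^ 2 < (0.55 + 0.45 * β) * ‖g x‖ ^ 2 := by
    calc β ^ 2 * ‖d‖ ^ 2 ≤ β ^ 2 * (0.81 * ‖g x‖ ^ 2) := by gcongr
      _ = (β ^ 2 * 0.81) * ‖g x‖ ^ 2 := by ring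
      _ < (0.55 + 0.45 * β) * ‖g x‖ ^ 2 := by
        gcongr
        nlinarith
  rw [hα, hnum, ← hd, mul_div_mul_left _ _ (by positivity), lt_div_iff₀ (by positivity), hden]
  linarith
end
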